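/- Fix an integer n with 2 ≤ n ≤ 5, let p = 2, and assume x₀ = y₀ = R > 0. Then λ_{1,2}(σ) < sup{λ_{1,2}(α) : α ∈ 𝒞}. -/

import Mathlib

open Set MeasureTheory Filter Topology

noncomputable section

/-- The closed quarter plane `P`. -/
def Pset : Set (ℝ × ℝ) := {z | 0 ≤ z.1 ∧ 0 ≤ z.2}

/-- The interior `P°` of the quarter plane. -/
def Pint : Set (ℝ × ℝ) := {z | 0 < z.1 ∧ 0 < z.2}

/-- The boundary `∂P` of the quarter plane. -/
def Pbdry : Set (ℝ × ℝ) := {z | (0 ≤ z.1 ∧ 0 ≤ z.2) ∧ (z.1 = 0 ∨ z.2 = 0)}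

/-- `F(x,y) = c_n x^(n-1) y^(n-1)`. -/
def Fvol (n : ℕ) (cn : ℝ) (z : ℝ × ℝ) : ℝ := cn * z.1 ^ (n - 1) * z.2 ^ (n - 1)

/-- Euclidean speed of a curve at `t`, computed with derivatives within `s`. -/
def gSpeedOn (s : Set ℝ) (α : ℝ → ℝ × ℝ) (t : ℝ) : ℝ :=
  Real.sqrt ((derivWithin (fun u => (α u).1) s t) ^ 2 + (derivWithin (fun u => (α u).2) s t) ^ 2)

/-- Euclidean speed of a curve defined on `[0,1]`. -/
def gSpeed (α : ℝ → ℝ × ℝ) : ℝ → ℝ := gSpeedOn (Icc 0 1) α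

/-- Euclidean length `L_g` of a curve on `[0,1]`. -/
def Lg (α : ℝ → ℝ × ℝ) : ℝ := ∫ t in (0:ℝ)..1, gSpeed α t

/-- The `h`-speed `|γ'|_h = F(γ) |γ'|_g`, with derivatives within `s`. -/
def hSpeedOn (n : ℕ) (cn : ℝ) (s : Set ℝ) (α : ℝ → ℝ × ℝ) (t : ℝ) : ℝ :=
  Fvol n cn (α t) * gSpeedOn s α t

/-- The `h`-speed for curves defined on `[0,1)`. -/
def hSpeed (n : ℕ) (cn : ℝ) (α : ℝ → ℝ × ℝ) : ℝ → ℝ := hSpeedOn n cn (Ico 0 1) α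

/-- The `h`-length `L_h` of a curve on `[0,1)`. -/
def Lh (n : ℕ) (cn : ℝ) (α : ℝ → ℝ × ℝ) : ℝ := ∫ t in (0:ℝ)..1, hSpeed n cn α t

/-- Numerator integrand of the `g`-Rayleigh quotient:
`|w'(t)|^p F(α t) |α'(t)|_g^(1-p)`. -/
def numG (n : ℕ) (cn p : ℝ) (s : Set ℝ) (α : ℝ → ℝ × ℝ) (w : ℝ → ℝ) (t : ℝ) : ℝ :=
  |derivWithin w (Icc 0 1) t| ^ p * Fvol n cn (α t) * gSpeedOn s α t ^ (1 - p)

/-- Denominator integrand of the `g`-Rayleigh quotient: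
`|w(t)|^p F(α t) |α'(t)|_g`. -/
def denG (n : ℕ) (cn p : ℝ) (s : Set ℝ) (α : ℝ → ℝ × ℝ) (w : ℝ → ℝ) (t : ℝ) : ℝ :=
  |w t| ^ p * Fvol n cn (α t) * gSpeedOn s α t

/-- First Dirichlet eigenvalue of the `p`-Laplacian along a curve, `g`-form:
infimum of the Rayleigh quotient over Lipschitz test functions on `[0,1]`
vanishing at `0` (with admissible, i.e. integrable with positive denominator,
Rayleigh quotients). -/
def lambdaGOn (n : ℕ) (cn p : ℝ) (s : Set ℝ) (α : ℝ → ℝ × ℝ) : ℝ :=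
  sInf {q | ∃ w : ℝ → ℝ, (∃ K, LipschitzOnWith K w (Icc 0 1)) ∧ w 0 = 0 ∧
    IntervalIntegrable (numG n cn p s α w) volume 0 1 ∧
    IntervalIntegrable (denG n cn p s α w) volume 0 1 ∧
    (0 < ∫ t in (0:ℝ)..1, denG n cn p s α w t) ∧
    q = (∫ t in (0:ℝ)..1, numG n cn p s α w t) / (∫ t in (0:ℝ)..1, denG n cn p s α w t)}

/-- `λ_{1,p}` in the `g`-form for curves on `[0,1]`. -/
def lambdaG (n : ℕ) (cn p : ℝ) (α : ℝ → ℝ × ℝ) : ℝ := lambdaGOn n cn p (Icc 0 1) α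

/-- Numerator integrand of the `h`-Rayleigh quotient on `[c,d]`:
`|w'(t)|^p F(γ t)^p |γ'(t)|_h^(1-p)`. -/
def numH (n : ℕ) (cn p c d : ℝ) (s : Set ℝ) (γ : ℝ → ℝ × ℝ) (w : ℝ → ℝ) (t : ℝ) : ℝ :=
  |derivWithin w (Icc c d) t| ^ p * Fvol n cn (γ t) ^ p * hSpeedOn n cn s γ t ^ (1 - p)

/-- Denominator integrand of the `h`-Rayleigh quotient: `|w(t)|^p |γ'(t)|_h`. -/
def denH (n : ℕ) (cn p : ℝ) (s : Set ℝ) (γ : ℝ → ℝ × ℝ) (w : ℝ → ℝ) (t : ℝ) : ℝ :=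
  |w t| ^ p * hSpeedOn n cn s γ t

/-- `λ_{1,p}` in the `h`-form for a curve on `[c,d)`, with test functions
Lipschitz on `[c,d]` vanishing at `c`. -/
def lambdaHOn (n : ℕ) (cn p c d : ℝ) (s : Set ℝ) (γ : ℝ → ℝ × ℝ) : ℝ :=
  sInf {q | ∃ w : ℝ → ℝ, (∃ K, LipschitzOnWith K w (Icc c d)) ∧ w c = 0 ∧
    IntervalIntegrable (numH n cn p c d s γ w) volume c d ∧
    IntervalIntegrable (denH n cn p s γ w) volume c d ∧
    (0 < ∫ t in c..d, denH n cn p s γ w t) ∧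
    q = (∫ t in c..d, numH n cn p c d s γ w t) / (∫ t in c..d, denH n cn p s γ w t)}

/-- `λ_{1,p}` in the `h`-form for curves on `[0,1)`. -/
def lambdaH (n : ℕ) (cn p : ℝ) (γ : ℝ → ℝ × ℝ) : ℝ :=
  lambdaHOn n cn p 0 1 (Ico 0 1) γ

/-- The class `𝒞` of `C¹` curves from `(x₀,y₀)` to the boundary, with constant
speed, interior image on `[0,1)`, endpoint away from the origin, and meeting the
boundary orthogonally. -/
def MemC (x0 y0 : ℝ) (α : ℝ → ℝ × ℝ) : Prop :=
  ContDiffOn ℝ 1 α (Icc 0 1) ∧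
  α 0 = (x0, y0) ∧
  (∀ t ∈ Ico (0:ℝ) 1, α t ∈ Pint) ∧
  α 1 ∈ Pbdry ∧ α 1 ≠ ((0 : ℝ), (0 : ℝ)) ∧
  (∀ t ∈ Icc (0:ℝ) 1, gSpeed α t = Lg α) ∧
  ((α 1).1 = 0 → derivWithin (fun u => (α u).2) (Icc 0 1) 1 = 0) ∧
  ((α 1).2 = 0 → derivWithin (fun u => (α u).1) (Icc 0 1) 1 = 0)

/-- The Simons cone curve `σ(t) = (1-t)·(R,R)`. -/
def simonsCurve (R : ℝ) : ℝ → ℝ × ℝ := fun t => ((1 - t) * R, (1 - t) * R)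

/-- The class `R_h`: locally Lipschitz curves on `[0,1)` with image in `P°`,
starting at `(x₀,y₀)`, with essentially bounded `h`-speed, reaching the collapsed
boundary point as `t → 1` (i.e. `x(γ t)·y(γ t) → 0`). -/
def MemRh (n : ℕ) (cn x0 y0 : ℝ) (γ : ℝ → ℝ × ℝ) : Prop :=
  γ 0 = (x0, y0) ∧
  (∀ t ∈ Ico (0:ℝ) 1, γ t ∈ Pint) ∧
  (∀ a ∈ Ico (0:ℝ) 1, ∃ K, LipschitzOnWith K γ (Icc 0 a)) ∧
  (∃ M : ℝ, ∀ᵐ t ∂(volume : Measure ℝ), t ∈ Ico (0:ℝ) 1 → hSpeed n cn γ t ≤ M) ∧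
  Tendsto (fun t => (γ t).1 * (γ t).2) (𝓝[<] (1:ℝ)) (𝓝 0)

/-- The class `R_h^+`: continuous curves on `[0,1]` into `P` ending on `∂P`
whose restriction to `[0,1)` belongs to `R_h`. -/
def MemRhPlus (n : ℕ) (cn x0 y0 : ℝ) (α : ℝ → ℝ × ℝ) : Prop :=
  ContinuousOn α (Icc 0 1) ∧ (∀ t ∈ Icc (0:ℝ) 1, α t ∈ Pset) ∧ α 1 ∈ Pbdry ∧
  MemRh n cn x0 y0 α

/-- The class `R_g`: Lipschitz curves on `[0,1]` from `(x₀,y₀)` to `∂P` with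
interior image on `[0,1)`. -/
def MemRg (x0 y0 : ℝ) (α : ℝ → ℝ × ℝ) : Prop :=
  (∃ K, LipschitzOnWith K α (Icc 0 1)) ∧ α 0 = (x0, y0) ∧ α 1 ∈ Pbdry ∧
  ∀ t ∈ Ico (0:ℝ) 1, α t ∈ Pint

/-- The coordinate `u(x,y) = (x² - y²)/2`. -/
def ucoord (z : ℝ × ℝ) : ℝ := (z.1 ^ 2 - z.2 ^ 2) / 2

/-- The coordinate `v(x,y) = xy`. -/
def vcoord (z : ℝ × ℝ) : ℝ := z.1 * z.2

/-- The coordinate `r = √(u² + v²)`. -/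
def rcoord (z : ℝ × ℝ) : ℝ := Real.sqrt (ucoord z ^ 2 + vcoord z ^ 2)

/-- The class `R_g^*`: simple curves in `R_g` with a.e. constant speed,
`u(α(1)) > 0`, and `v(α(t)) ≥ c(1-t)` for some `c > 0`. -/
def MemRgStar (x0 y0 : ℝ) (α : ℝ → ℝ × ℝ) : Prop :=
  MemRg x0 y0 α ∧ InjOn α (Icc 0 1) ∧
  (∀ᵐ t ∂(volume : Measure ℝ), t ∈ Icc (0:ℝ) 1 → gSpeed α t = Lg α) ∧
  0 < ucoord (α 1) ∧
  ∃ c > (0:ℝ), ∀ t ∈ Icc (0:ℝ) 1, c * (1 - t) ≤ vcoord (α t)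


theorem rayleigh_lower_bound {w f h h' : ℝ → ℝ} {κ : ℝ} {K : NNReal}
    (hw : LipschitzOnWith K w (Icc 0 1)) (hw0 : w 0 = 0)
    (hc : ContDiffOn ℝ 1 h (Icc 0 1)) (hd : ∀ t ∈ Ioo (0 : ℝ) 1, HasDerivAt h (h' t) t)
    (h1 : h 1 = 0) (hf : ∀ t ∈ Ioo (0 : ℝ) 1, 0 < f t)
    (hineq : ∀ t ∈ Ioo (0 : ℝ) 1, h' t * f t + h t ^ 2 + κ * f t ^ 2 ≤ 0)
    (hN : IntervalIntegrable (fun t => derivWithin w (Icc 0 1) t ^ 2 * f t) volume 0 1)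
    (hD : IntervalIntegrable (fun t => w t ^ 2 * f t) volume 0 1) :
    κ * ∫ t in (0 : ℝ)..1, w t ^ 2 * f t ≤
      ∫ t in (0 : ℝ)..1, derivWithin w (Icc 0 1) t ^ 2 * f t := by
  have hI : uIcc (0 : ℝ) 1 = Icc 0 1 := uIcc_of_le zero_le_one
  have hwa : AbsolutelyContinuousOnInterval w 0 1 := by
    rw [← hI] at hw
    exact hw.absolutelyContinuousOnInterval
  have hha : AbsolutelyContinuousOnInterval h 0 1 := by
    rw [← hI] at hc
    exact hc.absolutelyContinuousOnInterval
  have hG := (hwa.mul hwa).mul hha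
  have hGi := hG.intervalIntegrable_deriv
  have hG0 : ∫ t in (0 : ℝ)..1, deriv (w * w * h) t = 0 := by
    rw [hG.integral_deriv_eq_sub]
    simp [hw0, h1]
  have hle : ∫ t in (0 : ℝ)..1, (deriv (w * w * h) t + κ * (w t ^ 2 * f t)) ≤
      ∫ t in (0 : ℝ)..1, derivWithin w (Icc 0 1) t ^ 2 * f t := by
    apply intervalIntegral.integral_mono_ae_restrict zero_le_one (hGi.add (hD.const_mul κ)) hN
    rw [Filter.EventuallyLE, ae_restrict_iff' measurableSet_Icc]
    have e0 : ∀ᵐ t ∂(volume : Measure ℝ), t ≠ 0 := by simp [ae_iff]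
    have e1 : ∀ᵐ t ∂(volume : Measure ℝ), t ≠ 1 := by simp [ae_iff]
    filter_upwards [hwa.ae_differentiableAt, e0, e1] with t ht ht0 ht1 htI
    rw [hI] at ht
    have htO : t ∈ Ioo (0 : ℝ) 1 := ⟨lt_of_le_of_ne htI.1 ht0.symm, lt_of_le_of_ne htI.2 ht1⟩
    have hwd := (ht htI).hasDerivAt
    rw [derivWithin_of_mem_nhds (Icc_mem_nhds htO.1 htO.2),
      ((hwd.mul hwd).mul (hd t htO)).deriv]
    have hft := hf t htO
    have key := hineq t htO
    set a := deriv w t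
    have hsq := mul_nonneg (sq_nonneg (w t)) (neg_nonneg.mpr key)
    have : 0 ≤ (a ^ 2 * f t - ((a * w t + w t * a) * h t + w t * w t * h' t
        + κ * (w t ^ 2 * f t))) * f t := by
      nlinarith [sq_nonneg (a * f t - w t * h t)]
    simp only [Pi.mul_apply]
    linarith [nonneg_of_mul_nonneg_left this hft]
  rw [intervalIntegral.integral_add hGi (hD.const_mul κ), hG0,
    intervalIntegral.integral_const_mul] at hle
  linarith


/-- Evaluation of the polynomial with the given list of coefficients, in increasing degree. -/
def evalL : List ℝ → ℝ → ℝ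
  | [], _ => 0
  | a :: l, z => a + z * evalL l z

/-- Derivative of `evalL`. -/
def derivL : List ℝ → ℝ → ℝ
  | [], _ => 0
  | _ :: l, z => evalL l z + z * derivL l z

theorem hasDerivAt_evalL (l : List ℝ) (z : ℝ) : HasDerivAt (evalL l) (derivL l z) z := by
  induction l with
  | nil => exact hasDerivAt_const z 0
  | cons a l ih =>
    have h := ((hasDerivAt_id z).mul ih).const_add a
    simpa [evalL, derivL] using! h

theorem contDiff_evalL (l : List ℝ) : ContDiff ℝ 1 (evalL l) := by
  induction l with
  | nil => exact contDiff_const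
  | cons a l ih => exact contDiff_const.add (contDiff_id.mul ih)

theorem continuous_derivL (l : List ℝ) : Continuous (derivL l) := by
  induction l with
  | nil => exact continuous_const
  | cons a l ih => exact (contDiff_evalL l).continuous.add (continuous_id.mul ih)

/-- Half the slope parameter of the Pythagorean-hodograph profile curve. -/
def profQ (τ : ℝ) : ℝ := 18 / 25 * τ - 12 / 25 * τ ^ 3

/-- First coordinate of the profile curve, as a function of `z = τ²`. -/
def profX (z : ℝ) : ℝ := 9899 / 21875 + 18 / 25 * z - 6 / 25 * z ^ 2

/-- Second coordinate of the profile curve divided by `τ`, as a function of `z = τ²`. -/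
def profW (z : ℝ) : ℝ := 1 - 108 / 625 * z + 432 / 3125 * z ^ 2 - 144 / 4375 * z ^ 3

/-- Speed of the profile curve, as a function of `z = τ²`. -/
def profV (z : ℝ) : ℝ := 1 + 324 / 625 * z - 432 / 625 * z ^ 2 + 144 / 625 * z ^ 3

/-- Derivative in `τ` of the product of the coordinates of the profile curve,
as a function of `z = τ²`. -/
def profA (z : ℝ) : ℝ :=
  profX z * (1 - 324 / 625 * z + 432 / 625 * z ^ 2 - 144 / 625 * z ^ 3) +
    z * profW z * (36 / 25 - 24 / 25 * z)

/-- Arc length of the profile curve. -/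
def profS (τ : ℝ) : ℝ := τ + 108 / 625 * τ ^ 3 - 432 / 3125 * τ ^ 5 + 144 / 4375 * τ ^ 7

theorem profV_eq (τ : ℝ) : profV (τ ^ 2) = 1 + profQ τ ^ 2 := by
  unfold profV profQ; ring

theorem one_le_profV (τ : ℝ) : 1 ≤ profV (τ ^ 2) := by
  rw [profV_eq]; nlinarith [sq_nonneg (profQ τ)]

theorem hasDerivAt_profS (τ : ℝ) : HasDerivAt profS (profV (τ ^ 2)) τ := by
  have h := (((hasDerivAt_id τ).add ((hasDerivAt_pow 3 τ).const_mul (108 / 625))).sub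
    ((hasDerivAt_pow 5 τ).const_mul (432 / 3125))).add
    ((hasDerivAt_pow 7 τ).const_mul (144 / 4375))
  refine h.congr_deriv ?_
  unfold profV
  norm_num
  ring

theorem hasDerivAt_profX (τ : ℝ) : HasDerivAt (fun τ => profX (τ ^ 2)) (2 * profQ τ) τ := by
  have h := (((hasDerivAt_pow 2 τ).const_mul (18 / 25)).const_add (9899 / 21875)).sub
    ((hasDerivAt_pow 4 τ).const_mul (6 / 25))
  have e : (fun τ : ℝ => profX (τ ^ 2)) =
      (fun τ => 9899 / 21875 + 18 / 25 * τ ^ 2) - fun τ => 6 / 25 * τ ^ 4 := by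
    funext τ; simp only [profX, Pi.sub_apply]; ring
  rw [e]
  refine h.congr_deriv ?_
  unfold profQ
  norm_num
  ring

theorem hasDerivAt_profY (τ : ℝ) :
    HasDerivAt (fun τ => τ * profW (τ ^ 2)) (1 - profQ τ ^ 2) τ := by
  have h := ((hasDerivAt_id τ).const_mul 2).sub (hasDerivAt_profS τ)
  have e : (fun τ : ℝ => τ * profW (τ ^ 2)) = (fun τ => 2 * id τ) - profS := by
    funext τ; simp only [profW, profS, Pi.sub_apply, id]; ring
  rw [e]
  refine h.congr_deriv ?_
  rw [profV_eq]
  ring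

theorem profX_pos {z : ℝ} (h0 : 0 ≤ z) (h1 : z ≤ 1) : 0 < profX z := by
  unfold profX; nlinarith

theorem profW_pos {z : ℝ} (h0 : 0 ≤ z) (h1 : z ≤ 1) : 0 < profW z := by
  have : z ^ 3 ≤ 1 := pow_le_one₀ h0 h1
  unfold profW; nlinarith [sq_nonneg z]

theorem strictMono_profS : StrictMono profS :=
  strictMono_of_hasDerivAt_pos hasDerivAt_profS fun τ => zero_lt_one.trans_le (one_le_profV τ)

theorem surjective_profS : Function.Surjective profS := by
  have hc : Continuous profS := by unfold profS; fun_prop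
  have e : ∀ τ : ℝ, profS τ = τ * (1 + τ ^ 2 *
      (108 / 625 - 432 / 3125 * τ ^ 2 + 144 / 4375 * (τ ^ 2) ^ 2)) := fun τ => by
    unfold profS; ring
  have hp : ∀ z : ℝ, 0 ≤ z →
      0 ≤ z * (108 / 625 - 432 / 3125 * z + 144 / 4375 * z ^ 2) := fun z hz =>
    mul_nonneg hz (by nlinarith [sq_nonneg (z - 2.1)])
  refine hc.surjective ?_ ?_
  · refine tendsto_atTop_mono' _ ?_ tendsto_id
    filter_upwards [eventually_ge_atTop 0] with τ hτ
    rw [e, id]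
    nlinarith [mul_nonneg hτ (hp _ (sq_nonneg τ))]
  · refine tendsto_atBot_mono' _ ?_ tendsto_id
    filter_upwards [eventually_le_atBot 0] with τ hτ
    rw [e, id]
    nlinarith [mul_nonneg (neg_nonneg.mpr hτ) (hp _ (sq_nonneg τ))]

/-- Inverse of the arc length function of the profile curve. -/
def profT : ℝ → ℝ := (strictMono_profS.orderIsoOfSurjective profS surjective_profS).symm

theorem profS_profT (u : ℝ) : profS (profT u) = u :=
  (strictMono_profS.orderIsoOfSurjective profS surjective_profS).apply_symm_apply u

theorem profT_profS (τ : ℝ) : profT (profS τ) = τ :=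
  (strictMono_profS.orderIsoOfSurjective profS surjective_profS).symm_apply_apply τ

theorem strictMono_profT : StrictMono profT :=
  (strictMono_profS.orderIsoOfSurjective profS surjective_profS).symm.strictMono

theorem continuous_profT : Continuous profT :=
  (strictMono_profS.orderIsoOfSurjective profS surjective_profS).symm.continuous

theorem hasDerivAt_profT (u : ℝ) : HasDerivAt profT (profV (profT u ^ 2))⁻¹ u :=
  HasDerivAt.of_local_left_inverse continuous_profT.continuousAt (hasDerivAt_profS _)
    (zero_lt_one.trans_le (one_le_profV _)).ne' (Eventually.of_forall profS_profT)

theorem contDiff_profT : ContDiff ℝ 1 profT := by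
  rw [contDiff_one_iff_deriv]
  refine ⟨fun u => (hasDerivAt_profT u).differentiableAt, ?_⟩
  have : deriv profT = fun u => (profV (profT u ^ 2))⁻¹ :=
    funext fun u => (hasDerivAt_profT u).deriv
  rw [this]
  refine Continuous.inv₀ ?_ fun u => (zero_lt_one.trans_le (one_le_profV _)).ne'
  have := continuous_profT
  unfold profV
  fun_prop

theorem profS_zero : profS 0 = 0 := by norm_num [profS]

/-- Length of the profile curve. -/
def profL : ℝ := profS 1

theorem profL_pos : 0 < profL := by norm_num [profL, profS]

/-- The profile parameter at time `t` of the constant speed parametrization. -/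
def profP (t : ℝ) : ℝ := profT (profL * (1 - t))

theorem profP_zero : profP 0 = 1 := by
  simp [profP, profL, profT_profS]

theorem profP_one : profP 1 = 0 := by
  have := profT_profS 0
  rw [profS_zero] at this
  simp [profP, this]

theorem strictAnti_profP : StrictAnti profP := fun s t h => by
  apply strictMono_profT
  nlinarith [profL_pos]

theorem profP_mem {t : ℝ} (ht : t ∈ Icc (0 : ℝ) 1) : profP t ∈ Icc (0 : ℝ) 1 := by
  constructor
  · rw [← profP_one]; exact strictAnti_profP.antitone ht.2
  · rw [← profP_zero]; exact strictAnti_profP.antitone ht.1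

theorem profP_pos {t : ℝ} (ht : t < 1) : 0 < profP t := by
  rw [← profP_one]; exact strictAnti_profP ht

theorem hasDerivAt_profP (t : ℝ) :
    HasDerivAt profP (-profL / profV (profP t ^ 2)) t := by
  have h1 : HasDerivAt (fun t : ℝ => profL * (1 - t)) (-profL) t := by
    simpa using ((hasDerivAt_id t).const_sub 1).const_mul profL
  have h := (hasDerivAt_profT (profL * (1 - t))).comp t h1
  refine h.congr_deriv ?_
  rw [profP]
  ring

theorem contDiff_profP : ContDiff ℝ 1 profP :=
  contDiff_profT.comp (contDiff_const.mul (contDiff_const.sub contDiff_id))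

/-- The competitor curve from `(R, R)` to the first coordinate axis. -/
def competitor (R : ℝ) (t : ℝ) : ℝ × ℝ :=
  (21875 / 20399 * R * profX (profP t ^ 2),
    21875 / 20399 * R * (profP t * profW (profP t ^ 2)))

theorem hasDerivAt_competitor_fst (R t : ℝ) :
    HasDerivAt (fun u => (competitor R u).1)
      (21875 / 20399 * R * (2 * profQ (profP t) * (-profL / profV (profP t ^ 2)))) t :=
  ((hasDerivAt_profX (profP t)).comp t (hasDerivAt_profP t)).const_mul _

theorem hasDerivAt_competitor_snd (R t : ℝ) :
    HasDerivAt (fun u => (competitor R u).2)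
      (21875 / 20399 * R * ((1 - profQ (profP t) ^ 2) * (-profL / profV (profP t ^ 2)))) t :=
  ((hasDerivAt_profY (profP t)).comp t (hasDerivAt_profP t)).const_mul _

theorem gSpeed_competitor {R : ℝ} (hR : 0 < R) {t : ℝ} (ht : t ∈ Icc (0 : ℝ) 1) :
    gSpeed (competitor R) t = 21875 / 20399 * R * profL := by
  have hu := uniqueDiffOn_Icc (zero_lt_one' ℝ) t ht
  have hV := (zero_lt_one.trans_le (one_le_profV (profP t))).ne'
  rw [gSpeed, gSpeedOn, (hasDerivAt_competitor_fst R t).hasDerivWithinAt.derivWithin hu,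
    (hasDerivAt_competitor_snd R t).hasDerivWithinAt.derivWithin hu]
  have hp : 0 ≤ 21875 / 20399 * R * profL := by have := profL_pos; positivity
  rw [← Real.sqrt_sq hp]
  congr 1
  have hV' := profV_eq (profP t)
  field_simp
  rw [hV']
  ring

theorem memC_competitor {R : ℝ} (hR : 0 < R) : MemC R R (competitor R) := by
  have hX : ContDiff ℝ 1 profX := by unfold profX; fun_prop
  have hW : ContDiff ℝ 1 profW := by unfold profW; fun_prop
  have hP := contDiff_profP
  have hx0 : 0 < (competitor R 1).1 := by
    simp only [competitor, profP_one, profX]; norm_num; exact hR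
  refine ⟨?_, ?_, ?_, ?_, ?_, ?_, ?_, ?_⟩
  · exact (((contDiff_const.mul (hX.comp (hP.pow 2)))).prodMk
      (contDiff_const.mul (hP.mul (hW.comp (hP.pow 2))))).contDiffOn
  · simp only [competitor, profP_zero, profX, profW]
    ext <;> norm_num <;> ring
  · intro t ht
    have hm := profP_mem ⟨ht.1, ht.2.le⟩
    have hz : profP t ^ 2 ≤ 1 := pow_le_one₀ hm.1 hm.2
    exact ⟨mul_pos (by positivity) (profX_pos (sq_nonneg _) hz),
      mul_pos (by positivity) (mul_pos (profP_pos ht.2) (profW_pos (sq_nonneg _) hz))⟩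
  · have h2 : (competitor R 1).2 = 0 := by simp [competitor, profP_one]
    exact ⟨⟨hx0.le, h2.ge⟩, Or.inr h2⟩
  · intro h
    rw [h] at hx0
    exact lt_irrefl _ hx0
  · intro t ht
    rw [gSpeed_competitor hR ht, Lg, intervalIntegral.integral_congr
      (g := fun _ => 21875 / 20399 * R * profL)]
    · simp
    · intro s hs
      rw [uIcc_of_le zero_le_one] at hs
      exact gSpeed_competitor hR hs
  · intro h
    exact absurd h hx0.ne'
  · intro _
    rw [(hasDerivAt_competitor_fst R 1).hasDerivWithinAt.derivWithin
      (uniqueDiffOn_Icc (zero_lt_one' ℝ) 1 (by simp)), profP_one]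
    simp [profQ]


/-- `p` and `φ` (lists of coefficients in `z = τ²`) certify that `φ` is a positive supersolution
with eigenvalue parameter `μ` on the profile curve, for the weight of exponent `m`. -/
def IsSupersolution (m : ℕ) (μ : ℝ) (p φ : List ℝ) : Prop :=
  (∀ z ∈ Icc (0 : ℝ) 1, 0 < evalL φ z) ∧
  (∀ z, derivL φ z = -(profV z * evalL p z) / 2) ∧
  ∀ z ∈ Icc (0 : ℝ) 1, 0 ≤ m * profA z * evalL p z +
    profX z * profW z * (evalL p z + 2 * z * derivL p z) -
      μ * (profX z * profW z) * profV z * evalL φ z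

theorem hasDerivAt_profG (τ : ℝ) :
    HasDerivAt (fun τ => profX (τ ^ 2) * (τ * profW (τ ^ 2))) (profA (τ ^ 2)) τ := by
  refine ((hasDerivAt_profX τ).mul (hasDerivAt_profY τ)).congr_deriv ?_
  unfold profA profQ
  ring

theorem hasDerivAt_evalL_sq (l : List ℝ) (τ : ℝ) :
    HasDerivAt (fun τ => evalL l (τ ^ 2)) (derivL l (τ ^ 2) * (2 * τ)) τ := by
  have h := (hasDerivAt_evalL l (τ ^ 2)).comp τ (hasDerivAt_pow 2 τ)
  refine h.congr_deriv ?_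
  norm_num

theorem Fvol_competitor (m : ℕ) (cn R t : ℝ) :
    Fvol (m + 1) cn (competitor R t) = cn * (21875 / 20399 * R) ^ m * (21875 / 20399 * R) ^ m *
      (profX (profP t ^ 2) * (profP t * profW (profP t ^ 2))) ^ m := by
  simp only [Fvol, competitor, Nat.add_sub_cancel, mul_pow]
  ring

theorem continuous_Fvol_competitor (n : ℕ) (cn R : ℝ) :
    Continuous fun t => Fvol n cn (competitor R t) := by
  have := contDiff_profP.continuous
  unfold Fvol competitor profX profW
  fun_prop

theorem IsSupersolution.mul_integral_le {m : ℕ} (hm : m ≠ 0) {μ : ℝ} {p φ : List ℝ}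
    (hs : IsSupersolution m μ p φ) {cn R : ℝ} (hcn : 0 < cn) (hR : 0 < R)
    {w : ℝ → ℝ} {K : NNReal} (hw : LipschitzOnWith K w (Icc 0 1)) (hw0 : w 0 = 0)
    (hN : IntervalIntegrable (fun t => derivWithin w (Icc 0 1) t ^ 2 *
      Fvol (m + 1) cn (competitor R t)) volume 0 1)
    (hD : IntervalIntegrable (fun t => w t ^ 2 * Fvol (m + 1) cn (competitor R t)) volume 0 1) :
    μ * profL ^ 2 * ∫ t in (0 : ℝ)..1, w t ^ 2 * Fvol (m + 1) cn (competitor R t) ≤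
      ∫ t in (0 : ℝ)..1, derivWithin w (Icc 0 1) t ^ 2 * Fvol (m + 1) cn (competitor R t) := by
  obtain ⟨hφ, hφ', hineq⟩ := hs
  set k : ℝ := cn * (21875 / 20399 * R) ^ m * (21875 / 20399 * R) ^ m with hk
  have hk0 : 0 < k := by positivity
  have hf : ∀ t, Fvol (m + 1) cn (competitor R t) =
      k * (profX (profP t ^ 2) * (profP t * profW (profP t ^ 2))) ^ m :=
    Fvol_competitor m cn R
  let G : ℝ → ℝ := fun τ => profX (τ ^ 2) * (τ * profW (τ ^ 2))
  let H : ℝ → ℝ := fun τ => k * (G τ ^ m * (τ * evalL p (τ ^ 2))) / evalL φ (τ ^ 2)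
  let H' : ℝ → ℝ := fun τ =>
    (k * (m * G τ ^ (m - 1) * profA (τ ^ 2) * (τ * evalL p (τ ^ 2)) +
      G τ ^ m * (evalL p (τ ^ 2) + 2 * τ ^ 2 * derivL p (τ ^ 2))) * evalL φ (τ ^ 2) +
      k * (G τ ^ m * (τ * evalL p (τ ^ 2))) * (profV (τ ^ 2) * (τ * evalL p (τ ^ 2)))) /
      evalL φ (τ ^ 2) ^ 2
  have hsq : ∀ {τ : ℝ}, τ ∈ Icc (0 : ℝ) 1 → τ ^ 2 ∈ Icc (0 : ℝ) 1 := fun hτ =>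
    ⟨sq_nonneg _, pow_le_one₀ hτ.1 hτ.2⟩
  have hH : ∀ τ ∈ Icc (0 : ℝ) 1, HasDerivAt H (H' τ) τ := by
    intro τ hτ
    have hψ := (hasDerivAt_id τ).mul (hasDerivAt_evalL_sq p τ)
    have h := ((((hasDerivAt_profG τ).pow m).mul hψ).const_mul k).div
      (hasDerivAt_evalL_sq φ τ) (hφ _ (hsq hτ)).ne'
    refine h.congr_deriv ?_
    simp only [H', G, hφ', Pi.mul_apply, Pi.pow_apply, id]
    congr 1
    ring
  let h : ℝ → ℝ := fun t => profL * H (profP t)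
  refine rayleigh_lower_bound (h := h)
    (h' := fun t => profL * (H' (profP t) * (-profL / profV (profP t ^ 2)))) hw hw0
    ?_ ?_ ?_ ?_ ?_ hN hD
  · have hP := contDiff_profP
    have hX : ContDiff ℝ 1 profX := by unfold profX; fun_prop
    have hW : ContDiff ℝ 1 profW := by unfold profW; fun_prop
    have hnum : ContDiff ℝ 1 fun t => k * (G (profP t) ^ m * (profP t * evalL p (profP t ^ 2))) :=
      contDiff_const.mul ((((hX.comp (hP.pow 2)).mul (hP.mul (hW.comp (hP.pow 2)))).pow m).mul
        (hP.mul ((contDiff_evalL p).comp (hP.pow 2))))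
    exact contDiffOn_const.mul (hnum.contDiffOn.div
      ((contDiff_evalL φ).comp (hP.pow 2)).contDiffOn
      fun t ht => (hφ _ (hsq (profP_mem ht))).ne')
  · intro t ht
    exact ((hH _ (profP_mem (Ioo_subset_Icc_self ht))).comp t (hasDerivAt_profP t)).const_mul _
  · simp [h, H, profP_one]
  · intro t ht
    have hz := hsq (profP_mem (Ioo_subset_Icc_self ht))
    rw [hf]
    exact mul_pos hk0 (pow_pos (mul_pos (profX_pos hz.1 hz.2)
      (mul_pos (profP_pos ht.2) (profW_pos hz.1 hz.2))) m)
  · intro t ht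
    have hz := hsq (profP_mem (Ioo_subset_Icc_self ht))
    have hV := zero_lt_one.trans_le (one_le_profV (profP t))
    have hτ := profP_pos ht.2
    have hφz := hφ _ hz
    have hXW := mul_pos (profX_pos hz.1 hz.2) (profW_pos hz.1 hz.2)
    have key := hineq _ hz
    rw [hf]
    simp only [h, H, H', G]
    obtain ⟨j, rfl⟩ := Nat.exists_eq_succ_of_ne_zero hm
    simp only [Nat.succ_eq_add_one, Nat.add_sub_cancel] at *
    set τ := profP t
    set X := profX (τ ^ 2)
    set W := profW (τ ^ 2)
    set V := profV (τ ^ 2)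
    set A := profA (τ ^ 2)
    set P := evalL p (τ ^ 2)
    set P' := derivL p (τ ^ 2)
    set Φ := evalL φ (τ ^ 2)
    set M : ℝ := ((j + 1 : ℕ) : ℝ)
    have e : profL * ((k * (M * (X * (τ * W)) ^ j * A * (τ * P) + (X * (τ * W)) ^ (j + 1) *
        (P + 2 * τ ^ 2 * P')) * Φ + k * ((X * (τ * W)) ^ (j + 1) * (τ * P)) * (V * (τ * P))) /
        Φ ^ 2 * (-profL / V)) * (k * (X * (τ * W)) ^ (j + 1)) +
        (profL * (k * ((X * (τ * W)) ^ (j + 1) * (τ * P)) / Φ)) ^ 2 +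
        μ * profL ^ 2 * (k * (X * (τ * W)) ^ (j + 1)) ^ 2 =
        -(profL ^ 2 * k ^ 2 * (X * (τ * W)) ^ j * (X * (τ * W)) ^ (j + 1) * τ / (V * Φ) *
          (M * A * P + X * W * (P + 2 * τ ^ 2 * P') - μ * (X * W) * V * Φ)) := by
      rw [pow_succ (X * (τ * W)) j]
      generalize (X * (τ * W)) ^ j = q
      field_simp
      ring
    rw [e]
    refine neg_nonpos.mpr (mul_nonneg ?_ key)
    have : 0 < X * (τ * W) := by
      have := mul_pos hτ hXW
      nlinarith
    positivity

section ConstantSpeed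

variable {n : ℕ} {cn c : ℝ} {α : ℝ → ℝ × ℝ}

theorem numG_two_of_gSpeed (hα : ∀ t ∈ Icc (0 : ℝ) 1, gSpeed α t = c) (w : ℝ → ℝ) {t : ℝ}
    (ht : t ∈ Icc (0 : ℝ) 1) : numG n cn 2 (Icc 0 1) α w t =
      c⁻¹ * (derivWithin w (Icc 0 1) t ^ 2 * Fvol n cn (α t)) := by
  have hsp : gSpeedOn (Icc 0 1) α t = c := hα t ht
  rw [numG, hsp, Real.rpow_two, sq_abs, show (1 - 2 : ℝ) = -1 by norm_num, Real.rpow_neg_one]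
  ring

theorem denG_two_of_gSpeed (hα : ∀ t ∈ Icc (0 : ℝ) 1, gSpeed α t = c) (w : ℝ → ℝ) {t : ℝ}
    (ht : t ∈ Icc (0 : ℝ) 1) : denG n cn 2 (Icc 0 1) α w t =
      c * (w t ^ 2 * Fvol n cn (α t)) := by
  have hsp : gSpeedOn (Icc 0 1) α t = c := hα t ht
  rw [denG, hsp, Real.rpow_two, sq_abs]
  ring

theorem integral_numG_two_of_gSpeed (hα : ∀ t ∈ Icc (0 : ℝ) 1, gSpeed α t = c) (w : ℝ → ℝ) :
    ∫ t in (0 : ℝ)..1, numG n cn 2 (Icc 0 1) α w t =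
      c⁻¹ * ∫ t in (0 : ℝ)..1, derivWithin w (Icc 0 1) t ^ 2 * Fvol n cn (α t) := by
  rw [← intervalIntegral.integral_const_mul]
  refine intervalIntegral.integral_congr fun t ht => ?_
  rw [uIcc_of_le zero_le_one] at ht
  exact numG_two_of_gSpeed hα w ht

theorem integral_denG_two_of_gSpeed (hα : ∀ t ∈ Icc (0 : ℝ) 1, gSpeed α t = c) (w : ℝ → ℝ) :
    ∫ t in (0 : ℝ)..1, denG n cn 2 (Icc 0 1) α w t =
      c * ∫ t in (0 : ℝ)..1, w t ^ 2 * Fvol n cn (α t) := by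
  rw [← intervalIntegral.integral_const_mul]
  refine intervalIntegral.integral_congr fun t ht => ?_
  rw [uIcc_of_le zero_le_one] at ht
  exact denG_two_of_gSpeed hα w ht

theorem intervalIntegrable_numG_two_iff (hc : c ≠ 0)
    (hα : ∀ t ∈ Icc (0 : ℝ) 1, gSpeed α t = c) (w : ℝ → ℝ) :
    IntervalIntegrable (numG n cn 2 (Icc 0 1) α w) volume 0 1 ↔
      IntervalIntegrable (fun t => derivWithin w (Icc 0 1) t ^ 2 * Fvol n cn (α t))
        volume 0 1 := by
  have hsub : uIoc (0 : ℝ) 1 ⊆ Icc 0 1 := uIcc_of_le (zero_le_one' ℝ) ▸ uIoc_subset_uIcc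
  refine ⟨fun h => (h.const_mul c).congr fun t ht => ?_,
    fun h => (h.const_mul c⁻¹).congr fun t ht => (numG_two_of_gSpeed hα w (hsub ht)).symm⟩
  simp only [numG_two_of_gSpeed hα w (hsub ht)]
  field_simp

theorem intervalIntegrable_denG_two_iff (hc : c ≠ 0)
    (hα : ∀ t ∈ Icc (0 : ℝ) 1, gSpeed α t = c) (w : ℝ → ℝ) :
    IntervalIntegrable (denG n cn 2 (Icc 0 1) α w) volume 0 1 ↔
      IntervalIntegrable (fun t => w t ^ 2 * Fvol n cn (α t)) volume 0 1 := by
  have hsub : uIoc (0 : ℝ) 1 ⊆ Icc 0 1 := uIcc_of_le (zero_le_one' ℝ) ▸ uIoc_subset_uIcc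
  refine ⟨fun h => (h.const_mul c⁻¹).congr fun t ht => ?_,
    fun h => (h.const_mul c).congr fun t ht => (denG_two_of_gSpeed hα w (hsub ht)).symm⟩
  simp only [denG_two_of_gSpeed hα w (hsub ht)]
  field_simp

end ConstantSpeed

theorem IsSupersolution.le_lambdaG {m : ℕ} (hm : m ≠ 0) {μ : ℝ} {p φ : List ℝ}
    (hs : IsSupersolution m μ p φ) {cn R : ℝ} (hcn : 0 < cn) (hR : 0 < R) :
    μ * (20399 / 21875) ^ 2 / R ^ 2 ≤ lambdaG (m + 1) cn 2 (competitor R) := by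
  set c : ℝ := 21875 / 20399 * R * profL with hc
  have hc0 : 0 < c := by have := profL_pos; positivity
  have hsp : ∀ t ∈ Icc (0 : ℝ) 1, gSpeed (competitor R) t = c := fun t => gSpeed_competitor hR
  have hF := continuous_Fvol_competitor (m + 1) cn R
  have hFpos : ∀ t ∈ Ioo (0 : ℝ) 1, 0 < Fvol (m + 1) cn (competitor R t) := by
    intro t ht
    obtain ⟨h1, h2⟩ := (memC_competitor hR).2.2.1 t ⟨ht.1.le, ht.2⟩
    simp only [Fvol]
    positivity
  refine le_csInf ?_ ?_
  · have hFi : Continuous fun t => t ^ 2 * Fvol (m + 1) cn (competitor R t) :=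
      (continuous_id.pow 2).mul hF
    refine ⟨_, fun t => t, ⟨1, LipschitzWith.id.lipschitzOnWith⟩, rfl, ?_, ?_, ?_, rfl⟩
    · refine (intervalIntegrable_numG_two_iff hc0.ne' hsp _).mpr
        ((hF.intervalIntegrable 0 1).congr fun t ht => ?_)
      rw [uIoc_of_le zero_le_one] at ht
      simp only [derivWithin_id' t _ (uniqueDiffOn_Icc (zero_lt_one' ℝ) t (Ioc_subset_Icc_self ht)),
        one_pow, one_mul]
    · exact (intervalIntegrable_denG_two_iff hc0.ne' hsp _).mpr (hFi.intervalIntegrable 0 1)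
    · rw [integral_denG_two_of_gSpeed hsp]
      refine mul_pos hc0 (intervalIntegral.intervalIntegral_pos_of_pos_on
        (hFi.intervalIntegrable _ _) (fun t ht => ?_) zero_lt_one)
      exact mul_pos (pow_pos ht.1 2) (hFpos t ht)
  · rintro q ⟨w, ⟨K, hw⟩, hw0, hN, hD, hpos, rfl⟩
    have key := hs.mul_integral_le hm hcn hR hw hw0
      ((intervalIntegrable_numG_two_iff hc0.ne' hsp w).mp hN)
      ((intervalIntegrable_denG_two_iff hc0.ne' hsp w).mp hD)
    rw [integral_denG_two_of_gSpeed hsp] at hpos ⊢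
    rw [integral_numG_two_of_gSpeed hsp, le_div_iff₀ hpos]
    have e : μ * (20399 / 21875) ^ 2 / R ^ 2 * (c * ∫ t in (0 : ℝ)..1, w t ^ 2 *
        Fvol (m + 1) cn (competitor R t)) = c⁻¹ * (μ * profL ^ 2 *
        ∫ t in (0 : ℝ)..1, w t ^ 2 * Fvol (m + 1) cn (competitor R t)) := by
      have := profL_pos
      rw [hc]
      field_simp
    rw [e]
    exact mul_le_mul_of_nonneg_left key (inv_nonneg.mpr hc0.le)

theorem gSpeed_simonsCurve {R : ℝ} (hR : 0 < R) {t : ℝ} (ht : t ∈ Icc (0 : ℝ) 1) :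
    gSpeed (simonsCurve R) t = √2 * R := by
  have h : HasDerivAt (fun u : ℝ => (1 - u) * R) (-R) t := by
    simpa using ((hasDerivAt_id t).const_sub 1).mul_const R
  have hd := h.hasDerivWithinAt.derivWithin (uniqueDiffOn_Icc (zero_lt_one' ℝ) t ht)
  simp only [gSpeed, gSpeedOn, simonsCurve, hd]
  rw [show (-R) ^ 2 + (-R) ^ 2 = 2 * R ^ 2 by ring, Real.sqrt_mul zero_le_two,
    Real.sqrt_sq hR.le]

theorem integral_eq_evalL {f : ℝ → ℝ} {l : List ℝ} (h : ∀ u, derivL l u = f u) :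
    ∫ t in (0 : ℝ)..1, f (1 - t) = evalL l 1 - evalL l 0 := by
  rw [intervalIntegral.integral_comp_sub_left, sub_self, sub_zero]
  refine intervalIntegral.integral_eq_sub_of_hasDerivAt (fun u _ => h u ▸ hasDerivAt_evalL l u) ?_
  rw [← funext h]
  exact (continuous_derivL l).intervalIntegrable _ _

/-- Upper bound for the eigenvalue of the Simons cone curve by the Rayleigh quotient of the
polynomial test function `evalL ω`; `N` and `D` are antiderivatives of its numerator and
denominator. -/
theorem lambdaG_simonsCurve_le {m : ℕ} {ω N D : List ℝ} (hω : evalL ω 1 = 0)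
    (hN : ∀ u, derivL N u = derivL ω u ^ 2 * u ^ (2 * m))
    (hD : ∀ u, derivL D u = evalL ω u ^ 2 * u ^ (2 * m))
    (hpos : 0 < evalL D 1 - evalL D 0) {cn R : ℝ} (hcn : 0 < cn) (hR : 0 < R) :
    lambdaG (m + 1) cn 2 (simonsCurve R) ≤
      (evalL N 1 - evalL N 0) / (evalL D 1 - evalL D 0) / 2 / R ^ 2 := by
  have hsp : ∀ t ∈ Icc (0 : ℝ) 1, gSpeed (simonsCurve R) t = √2 * R :=
    fun t => gSpeed_simonsCurve hR
  have hc0 : 0 < √2 * R := by positivity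
  have hF : ∀ t, Fvol (m + 1) cn (simonsCurve R t) = cn * R ^ (2 * m) * (1 - t) ^ (2 * m) := by
    intro t
    simp only [Fvol, simonsCurve, Nat.add_sub_cancel, mul_pow, two_mul, pow_add]
    ring
  have hk : 0 < cn * R ^ (2 * m) := by positivity
  have hF0 : ∀ t, 0 ≤ Fvol (m + 1) cn (simonsCurve R t) := by
    intro t
    rw [hF, pow_mul (1 - t)]
    positivity
  let w : ℝ → ℝ := fun t => evalL ω (1 - t)
  have hwc : ContDiff ℝ 1 w := (contDiff_evalL ω).comp (contDiff_const.sub contDiff_id)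
  have hwd : ∀ t ∈ Icc (0 : ℝ) 1, derivWithin w (Icc 0 1) t = -derivL ω (1 - t) := by
    intro t ht
    have h := (hasDerivAt_evalL ω (1 - t)).comp t ((hasDerivAt_id t).const_sub 1)
    rw [mul_neg_one] at h
    exact h.hasDerivWithinAt.derivWithin (uniqueDiffOn_Icc (zero_lt_one' ℝ) t ht)
  have hNc : Continuous fun t => cn * R ^ (2 * m) * (derivL ω (1 - t) ^ 2 * (1 - t) ^ (2 * m)) := by
    have := continuous_derivL ω
    fun_prop
  have hDc : Continuous fun t => cn * R ^ (2 * m) * (evalL ω (1 - t) ^ 2 * (1 - t) ^ (2 * m)) := by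
    have := (contDiff_evalL ω).continuous
    fun_prop
  have eN : ∀ t ∈ Icc (0 : ℝ) 1, derivWithin w (Icc 0 1) t ^ 2 *
      Fvol (m + 1) cn (simonsCurve R t) =
      cn * R ^ (2 * m) * (derivL ω (1 - t) ^ 2 * (1 - t) ^ (2 * m)) := by
    intro t ht
    rw [hwd t ht, hF]
    ring
  have eD : ∀ t, w t ^ 2 * Fvol (m + 1) cn (simonsCurve R t) =
      cn * R ^ (2 * m) * (evalL ω (1 - t) ^ 2 * (1 - t) ^ (2 * m)) := by
    intro t
    rw [hF]
    ring
  have iN : ∫ t in (0 : ℝ)..1, derivWithin w (Icc 0 1) t ^ 2 *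
      Fvol (m + 1) cn (simonsCurve R t) =
      cn * R ^ (2 * m) * (evalL N 1 - evalL N 0) := by
    rw [← integral_eq_evalL hN, ← intervalIntegral.integral_const_mul]
    refine intervalIntegral.integral_congr fun t ht => ?_
    rw [uIcc_of_le zero_le_one] at ht
    exact eN t ht
  have iD : ∫ t in (0 : ℝ)..1, w t ^ 2 * Fvol (m + 1) cn (simonsCurve R t) =
      cn * R ^ (2 * m) * (evalL D 1 - evalL D 0) := by
    rw [← integral_eq_evalL hD, ← intervalIntegral.integral_const_mul]
    exact intervalIntegral.integral_congr fun t _ => eD t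
  refine csInf_le ⟨0, ?_⟩ ⟨w, ?_, ?_, ?_, ?_, ?_, ?_⟩
  · rintro q ⟨v, -, -, -, -, hq, rfl⟩
    refine div_nonneg ?_ hq.le
    rw [integral_numG_two_of_gSpeed hsp]
    exact mul_nonneg (inv_nonneg.mpr hc0.le) (intervalIntegral.integral_nonneg zero_le_one
      fun t _ => mul_nonneg (sq_nonneg _) (hF0 t))
  · exact hwc.contDiffOn.exists_lipschitzOnWith one_ne_zero (convex_Icc _ _) isCompact_Icc
  · simpa [w] using hω
  · refine (intervalIntegrable_numG_two_iff hc0.ne' hsp w).mpr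
      ((hNc.intervalIntegrable 0 1).congr fun t ht => ?_)
    rw [uIoc_of_le zero_le_one] at ht
    exact (eN t (Ioc_subset_Icc_self ht)).symm
  · refine (intervalIntegrable_denG_two_iff hc0.ne' hsp w).mpr ?_
    rw [funext eD]
    exact hDc.intervalIntegrable 0 1
  · rw [integral_denG_two_of_gSpeed hsp, iD]
    positivity
  · rw [integral_numG_two_of_gSpeed hsp, integral_denG_two_of_gSpeed hsp, iN, iD]
    have h2 : √2 ^ 2 = 2 := Real.sq_sqrt zero_le_two
    field_simp
    rw [h2]

/-- Weight exponent `1`: coefficients of the flux polynomial. -/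
def fluxOne : List ℝ :=
  [299 / 100, -73 / 25, 19 / 20]

/-- Weight exponent `1`: coefficients of the supersolution. -/
def superOne : List ℝ :=
  [3747977 / 3750000, -299 / 200, 10703 / 31250, 164401 / 375000, -9999 / 25000, 10386 / 78125,
   -57 / 3125]

theorem isSupersolution_one : IsSupersolution 1 (2917 / 500) fluxOne superOne := by
  refine ⟨fun z hz => ?_, fun z => ?_, fun z hz => ?_⟩
  · have h0 : 0 ≤ z := hz.1
    have h1 : 0 ≤ 1 - z := sub_nonneg.2 hz.2
    have h : evalL superOne z = 1 / 20000 + (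
        7495579 / 7500000 * (1 - z) ^ 6 +
        5626829 / 1250000 * z * (1 - z) ^ 5 +
        3929327 / 500000 * z ^ 2 * (1 - z) ^ 4 +
        1283737 / 187500 * z ^ 3 * (1 - z) ^ 3 +
        1505691 / 500000 * z ^ 4 * (1 - z) ^ 2 +
        134919 / 250000 * z ^ 5 * (1 - z) +
        1 / 20000 * z ^ 6) := by
      simp only [superOne, evalL]; ring
    rw [h]; positivity
  · simp only [superOne, fluxOne, derivL, evalL, profV]; ring
  · have h : 1 * profA z * evalL fluxOne z +
        profX z * profW z * (evalL fluxOne z + 2 * z * derivL fluxOne z) -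
        2917 / 500 * (profX z * profW z) * profV z * evalL superOne z =
        evalL [2768266149809 / 41015625000000, 655398001150703 / 534057617187500,
         -15212330698159981963 / 2670288085937500000, 3289978895939528754337 / 280380249023437500000,
         -1329559602409781034627 / 93460083007812500000, 32392951100223095027 / 2920627593994140625,
         -38600324742237597561 / 9346008300781250000, -156410681390867601 / 584125518798828125,
         7285081872526873911 / 5841255187988281250, -2543428704065029254 / 2920627593994140625,
         1139208352458795288 / 2920627593994140625, -71933079296941488 / 584125518798828125,
         615804212362032 / 23365020751953125, -2261091500928 / 667572021484375,
         5171630976 / 26702880859375] z := by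
      simp only [fluxOne, superOne, derivL, evalL, profA, profX, profW, profV]; ring
    push_cast
    rw [h]
    have h0 : 0 ≤ z := hz.1
    have h1 : 0 ≤ 1 - z := sub_nonneg.2 hz.2
    refine le_of_le_of_eq (b :=
      2768266149809 / 41015625000000 * (1 - z) ^ 14 +
      27840716433031247 / 12817382812500000 * z * (1 - z) ^ 13 +
      262734447053806075097 / 16021728515625000000 * z ^ 2 * (1 - z) ^ 12 +
      5949738372986221704069 / 93460083007812500000 * z ^ 3 * (1 - z) ^ 11 +
      29420176840318849692449 / 186920166015625000000 * z ^ 4 * (1 - z) ^ 10 +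
      912764240715934102963 / 3337860107421875000 * z ^ 5 * (1 - z) ^ 9 +
      66125654758129253773897 / 186920166015625000000 * z ^ 6 * (1 - z) ^ 8 +
      16666536705234751935017 / 46730041503906250000 * z ^ 7 * (1 - z) ^ 7 +
      10978655795965974558479 / 37384033203125000000 * z ^ 8 * (1 - z) ^ 6 +
      57740955923088758608493 / 280380249023437500000 * z ^ 9 * (1 - z) ^ 5 +
      13857109255657256202421 / 112152099609375000000 * z ^ 10 * (1 - z) ^ 4 +
      68538303233637897679 / 1144409179687500000 * z ^ 11 * (1 - z) ^ 3 +
      112574276557838781121 / 5340576171875000000 * z ^ 12 * (1 - z) ^ 2 +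
      43210597424120575443 / 9346008300781250000 * z ^ 13 * (1 - z) +
      99424486846020209 / 213623046875000000 * z ^ 14) ?_ ?_
    · positivity
    · simp only [evalL]; ring

theorem lambdaG_simonsCurve_lt_one {cn R : ℝ} (hcn : 0 < cn) (hR : 0 < R) :
    lambdaG (1 + 1) cn 2 (simonsCurve R) < 2917 / 500 * (20399 / 21875) ^ 2 / R ^ 2 := by
  refine (lambdaG_simonsCurve_le (m := 1)
    (ω := [1, 0, -8 / 5, 0, 4 / 5, 0, -1 / 5])
    (N := [0, 0, 0, 0, 0, 256 / 125, 0, -512 / 175, 0, 448 / 225, 0, -192 / 275, 0, 36 / 325])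
    (D := [0, 0, 0, 1 / 3, 0, -16 / 25, 0, 104 / 175, 0, -74 / 225, 0, 32 / 275, 0, -8 / 325, 0,
           1 / 375])
    ?_ (fun u => ?_) (fun u => ?_) ?_ hcn hR).trans_lt
      (div_lt_div_of_pos_right ?_ (by positivity))
  · norm_num [evalL]
  · simp only [evalL, derivL]; ring
  · simp only [evalL, derivL]; ring
  · norm_num [evalL]
  · norm_num [evalL]

/-- Weight exponent `2`: coefficients of the flux polynomial. -/
def fluxTwo : List ℝ :=
  [393 / 100, -73 / 10, 797 / 100, -589 / 100, 197 / 100]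

/-- Weight exponent `2`: coefficients of the supersolution. -/
def superTwo : List ℝ :=
  [10526933 / 10500000, -393 / 200, 164459 / 125000, -91829 / 375000, -52411 / 100000,
   103427 / 125000, -36087 / 62500, 4248 / 21875, -1773 / 62500]

theorem isSupersolution_two : IsSupersolution 2 (2343 / 200) fluxTwo superTwo := by
  refine ⟨fun z hz => ?_, fun z => ?_, fun z hz => ?_⟩
  · have h0 : 0 ≤ z := hz.1
    have h1 : 0 ≤ 1 - z := sub_nonneg.2 hz.2
    have h : evalL superTwo z = 1 / 20000 + (
        1315801 / 1312500 * (1 - z) ^ 8 +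
        15894691 / 2625000 * z * (1 - z) ^ 7 +
        293083 / 18750 * z ^ 2 * (1 - z) ^ 6 +
        4223437 / 187500 * z ^ 3 * (1 - z) ^ 5 +
        5816291 / 300000 * z ^ 4 * (1 - z) ^ 4 +
        3735557 / 375000 * z ^ 5 * (1 - z) ^ 3 +
        712981 / 250000 * z ^ 6 * (1 - z) ^ 2 +
        22499 / 62500 * z ^ 7 * (1 - z) +
        1 / 20000 * z ^ 8) := by
      simp only [superTwo, evalL]; ring
    rw [h]; positivity
  · simp only [superTwo, fluxTwo, derivL, evalL, profV]; ring
  · have h : 2 * profA z * evalL fluxTwo z +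
        profX z * profW z * (evalL fluxTwo z + 2 * z * derivL fluxTwo z) -
        2343 / 200 * (profX z * profW z) * profV z * evalL superTwo z =
        evalL [311475271973 / 15312500000000, 6042121252544959 / 4785156250000000,
         -5750047889141728819 / 427246093750000000, 2826323288809383876407 / 52337646484375000000,
         -20617099764221902066409 / 209350585937500000000,
         9850116028033461847497 / 104675292968750000000,
         -1205275213740783776673 / 20935058593750000000, 100307527602940415727 / 3738403320312500000,
         -16363266353635986999 / 3738403320312500000, -1937550741932487537 / 373840332031250000,
         69456803826961831401 / 13084411621093750000, -194335837697980737 / 65422058105468750,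
         988047487318528197 / 817775726318359375, -300386781427501494 / 817775726318359375,
         1837105282279872 / 23365020751953125, -9635762681424 / 934600830078125,
         16151292432 / 26702880859375] z := by
      simp only [fluxTwo, superTwo, derivL, evalL, profA, profX, profW, profV]; ring
    push_cast
    rw [h]
    rcases le_total z (1 / 2) with hu | hl
    · have h0 : 0 ≤ z := hz.1
      have h1 : 0 ≤ 1 / 2 - z := sub_nonneg.2 hu
      refine le_of_le_of_eq (b :=
        79737669625088 / 59814453125 * (1 / 2 - z) ^ 16 +
        334879962414627072 / 5340576171875 * z * (1 / 2 - z) ^ 15 +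
        13086751361112912578176 / 23365020751953125 * z ^ 2 * (1 / 2 - z) ^ 14 +
        2000527185282332407486336 / 817775726318359375 * z ^ 3 * (1 / 2 - z) ^ 13 +
        5343294126186729834769264 / 817775726318359375 * z ^ 4 * (1 / 2 - z) ^ 12 +
        9727912573099309272819152 / 817775726318359375 * z ^ 5 * (1 / 2 - z) ^ 11 +
        269737659499368661858536 / 16689300537109375 * z ^ 6 * (1 / 2 - z) ^ 10 +
        15106540429591209429490864 / 817775726318359375 * z ^ 7 * (1 / 2 - z) ^ 9 +
        16503582913717713086174304 / 817775726318359375 * z ^ 8 * (1 / 2 - z) ^ 8 +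
        3499636996191054017258024 / 163555145263671875 * z ^ 9 * (1 / 2 - z) ^ 7 +
        16168450029079851876385452 / 817775726318359375 * z ^ 10 * (1 / 2 - z) ^ 6 +
        11721941701785956094526832 / 817775726318359375 * z ^ 11 * (1 / 2 - z) ^ 5 +
        6266429496894541594638436 / 817775726318359375 * z ^ 12 * (1 / 2 - z) ^ 4 +
        337122422120209543499512 / 116825103759765625 * z ^ 13 * (1 / 2 - z) ^ 3 +
        590158847638176651864572 / 817775726318359375 * z ^ 14 * (1 / 2 - z) ^ 2 +
        87825368424192218812512 / 817775726318359375 * z ^ 15 * (1 / 2 - z) +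
        5880498642174499915948 / 817775726318359375 * z ^ 16) ?_ ?_
      · positivity
      · simp only [evalL]; ring
    · have h0 : 0 ≤ z - 1 / 2 := sub_nonneg.2 hl
      have h1 : 0 ≤ 1 - z := sub_nonneg.2 hz.2
      refine le_of_le_of_eq (b :=
        5880498642174499915948 / 817775726318359375 * (1 - z) ^ 16 +
        100350588125391778497824 / 817775726318359375 * (z - 1 / 2) * (1 - z) ^ 15 +
        778037143156170047144252 / 817775726318359375 * (z - 1 / 2) ^ 2 * (1 - z) ^ 14 +
        517509993972643881414776 / 116825103759765625 * (z - 1 / 2) ^ 3 * (1 - z) ^ 13 +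
        2256749721474893406258708 / 163555145263671875 * (z - 1 / 2) ^ 4 * (1 - z) ^ 12 +
        24786092459740650789780656 / 817775726318359375 * (z - 1 / 2) ^ 5 * (1 - z) ^ 11 +
        39414026872670848271331436 / 817775726318359375 * (z - 1 / 2) ^ 6 * (1 - z) ^ 10 +
        6548880788515085959616344 / 116825103759765625 * (z - 1 / 2) ^ 7 * (1 - z) ^ 9 +
        39073267330203344394145152 / 817775726318359375 * (z - 1 / 2) ^ 8 * (1 - z) ^ 8 +
        4936048764833301887743376 / 163555145263671875 * (z - 1 / 2) ^ 9 * (1 - z) ^ 7 +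
        1792234550777977845151352 / 116825103759765625 * (z - 1 / 2) ^ 10 * (1 - z) ^ 6 +
        940546074103940619950384 / 116825103759765625 * (z - 1 / 2) ^ 11 * (1 - z) ^ 5 +
        590693537742325582899536 / 116825103759765625 * (z - 1 / 2) ^ 12 * (1 - z) ^ 4 +
        336185712146417641320576 / 116825103759765625 * (z - 1 / 2) ^ 13 * (1 - z) ^ 3 +
        26361688099772295389824 / 23365020751953125 * (z - 1 / 2) ^ 14 * (1 - z) ^ 2 +
        30098951702643961149952 / 116825103759765625 * (z - 1 / 2) ^ 15 * (1 - z) +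
        120693488178006874624 / 4673004150390625 * (z - 1 / 2) ^ 16) ?_ ?_
      · positivity
      · simp only [evalL]; ring

theorem lambdaG_simonsCurve_lt_two {cn R : ℝ} (hcn : 0 < cn) (hR : 0 < R) :
    lambdaG (2 + 1) cn 2 (simonsCurve R) < 2343 / 200 * (20399 / 21875) ^ 2 / R ^ 2 := by
  refine (lambdaG_simonsCurve_le (m := 2)
    (ω := [49 / 50, 0, -101 / 50, 0, 73 / 50, 0, -27 / 50, 0, 3 / 25])
    (N := [0, 0, 0, 0, 0, 0, 0, 10201 / 4375, 0, -29492 / 5625, 0, 37678 / 6875, 0, -228 / 65, 0,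
           4523 / 3125, 0, -3888 / 10625, 0, 576 / 11875])
    (D := [0, 0, 0, 0, 0, 2401 / 12500, 0, -707 / 1250, 0, 1157 / 1500, 0, -4348 / 6875, 0,
           11371 / 32500, 0, -859 / 6250, 0, 321 / 8500, 0, -81 / 11875, 0, 3 / 4375])
    ?_ (fun u => ?_) (fun u => ?_) ?_ hcn hR).trans_lt
      (div_lt_div_of_pos_right ?_ (by positivity))
  · norm_num [evalL]
  · simp only [evalL, derivL]; ring
  · simp only [evalL, derivL]; ring
  · norm_num [evalL]
  · norm_num [evalL]

/-- Weight exponent `3`: coefficients of the flux polynomial. -/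
def fluxThree : List ℝ :=
  [599 / 125, -1572 / 125, 11677 / 500, -38103 / 1000, 4297 / 100, -27027 / 1000, 3521 / 500]

/-- Weight exponent `3`: coefficients of the supersolution. -/
def superThree : List ℝ :=
  [14996837 / 15000000, -599 / 250, 197106 / 78125, -4225741 / 1875000, 10124799 / 5000000,
   -1305503 / 3125000, -5617959 / 2500000, 405791 / 125000, -2518119 / 1250000, 48153 / 78125,
   -31689 / 390625]

theorem isSupersolution_three : IsSupersolution 3 (9569 / 500) fluxThree superThree := by
  refine ⟨fun z hz => ?_, fun z => ?_, fun z hz => ?_⟩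
  · have h0 : 0 ≤ z := hz.1
    have h1 : 0 ≤ 1 - z := sub_nonneg.2 hz.2
    have h : evalL superThree z = 1 / 20000 + (
        14996087 / 15000000 * (1 - z) ^ 10 +
        11402087 / 1500000 * z * (1 - z) ^ 9 +
        129736089 / 5000000 * z ^ 2 * (1 - z) ^ 8 +
        24207479 / 468750 * z ^ 3 * (1 - z) ^ 7 +
        983593027 / 15000000 * z ^ 4 * (1 - z) ^ 6 +
        696594263 / 12500000 * z ^ 5 * (1 - z) ^ 5 +
        477211559 / 15000000 * z ^ 6 * (1 - z) ^ 4 +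
        43833593 / 3750000 * z ^ 7 * (1 - z) ^ 3 +
        6212317 / 2500000 * z ^ 8 * (1 - z) ^ 2 +
        299397 / 1250000 * z ^ 9 * (1 - z) +
        1 / 20000 * z ^ 10) := by
      simp only [superThree, evalL]; ring
    rw [h]; positivity
  · simp only [superThree, fluxThree, derivL, evalL, profV]; ring
  · have h : 3 * profA z * evalL fluxThree z +
        profX z * profW z * (evalL fluxThree z + 2 * z * derivL fluxThree z) -
        9569 / 500 * (profX z * profW z) * profV z * evalL superThree z =
        evalL [2526885528553 / 164062500000000, 1442829946724969 / 2441406250000000,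
         -125208829055060819721 / 10681152343750000000,
         25343697611072485930751 / 280380249023437500000,
         -250235309148897899869263 / 747680664062500000000,
         251608341538751742419641 / 373840332031250000000,
         -10595707775420159710327 / 13351440429687500000,
         112991492307790075975397 / 186920166015625000000,
         -23159012841721352299371 / 66757202148437500000,
         9804135225309964310763 / 66757202148437500000, -118000814486362583913 / 9536743164062500000,
         -12008834797378069611 / 333786010742187500, 13339380107263750713 / 417232513427734375,
         -35547502794458730687 / 2086162567138671875, 13967421500154340116 / 2086162567138671875,
         -584239273168280616 / 298023223876953125, 23940396939205656 / 59604644775390625,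
         -119902523069952 / 2384185791015625, 1347389914752 / 476837158203125] z := by
      simp only [fluxThree, superThree, derivL, evalL, profA, profX, profW, profV]; ring
    push_cast
    rw [h]
    rcases le_total z (1 / 2) with hu | hl
    · have h0 : 0 ≤ z := hz.1
      have h1 : 0 ≤ 1 / 2 - z := sub_nonneg.2 hu
      refine le_of_le_of_eq (b :=
        2587530781238272 / 640869140625 * (1 / 2 - z) ^ 18 +
        20045445487768097792 / 133514404296875 * z * (1 / 2 - z) ^ 17 +
        13903924721266242763264 / 11920928955078125 * z ^ 2 * (1 / 2 - z) ^ 16 +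
        39423640375688439695473664 / 8761882781982421875 * z ^ 3 * (1 / 2 - z) ^ 15 +
        34419831570498810301773888 / 2920627593994140625 * z ^ 4 * (1 / 2 - z) ^ 14 +
        83190619720833134221934016 / 2920627593994140625 * z ^ 5 * (1 / 2 - z) ^ 13 +
        641292562351591674100860544 / 8761882781982421875 * z ^ 6 * (1 / 2 - z) ^ 12 +
        498873633309285614724381984 / 2920627593994140625 * z ^ 7 * (1 / 2 - z) ^ 11 +
        4561776465352498825405124736 / 14603137969970703125 * z ^ 8 * (1 / 2 - z) ^ 10 +
        6263709625370520290052600496 / 14603137969970703125 * z ^ 9 * (1 / 2 - z) ^ 9 +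
        6447351327824998463311188488 / 14603137969970703125 * z ^ 10 * (1 / 2 - z) ^ 8 +
        5000106490357500682791391648 / 14603137969970703125 * z ^ 11 * (1 / 2 - z) ^ 7 +
        8779195560327218127194027008 / 43809413909912109375 * z ^ 12 * (1 / 2 - z) ^ 6 +
        1287010366542510735307565664 / 14603137969970703125 * z ^ 13 * (1 / 2 - z) ^ 5 +
        420546485165209003362387888 / 14603137969970703125 * z ^ 14 * (1 / 2 - z) ^ 4 +
        299989683202518818321757632 / 43809413909912109375 * z ^ 15 * (1 / 2 - z) ^ 3 +
        16642130285090242765062624 / 14603137969970703125 * z ^ 16 * (1 / 2 - z) ^ 2 +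
        253938536290201320662544 / 2086162567138671875 * z ^ 17 * (1 / 2 - z) +
        282371667196549777068344 / 43809413909912109375 * z ^ 18) ?_ ?_
      · positivity
      · simp only [evalL]; ring
    · rcases le_total z (3 / 4) with hu | hl
      · have h0 : 0 ≤ z - 1 / 2 := sub_nonneg.2 hl
        have h1 : 0 ≤ 3 / 4 - z := sub_nonneg.2 hu
        refine le_of_le_of_eq (b :=
          74022038325572344759803969536 / 43809413909912109375 * (3 / 4 - z) ^ 18 +
          433208722129746230325068955648 / 14603137969970703125 * (z - 1 / 2) * (3 / 4 - z) ^ 17 +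
          520493166687539494564699570176 / 2086162567138671875 * (z - 1 / 2) ^ 2 * (3 / 4 - z) ^ 16 +
          58669580704858966651928060100608 / 43809413909912109375 * (z - 1 / 2) ^ 3 * (3 / 4 - z) ^ 15 +
          75162720744032792815863131799552 / 14603137969970703125 * (z - 1 / 2) ^ 4 * (3 / 4 - z) ^ 14 +
          219516932405128017876390731317248 / 14603137969970703125 * (z - 1 / 2) ^ 5 * (3 / 4 - z) ^ 13 +
          1511125838049006078118495952502784 / 43809413909912109375 * (z - 1 / 2) ^ 6 * (3 / 4 - z) ^ 12 +
          925192581661755511374301192585216 / 14603137969970703125 * (z - 1 / 2) ^ 7 * (3 / 4 - z) ^ 11 +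
          1373151816309391330118786983337984 / 14603137969970703125 * (z - 1 / 2) ^ 8 * (3 / 4 - z) ^ 10 +
          1652003352888575629359484233662464 / 14603137969970703125 * (z - 1 / 2) ^ 9 * (3 / 4 - z) ^ 9 +
          1608492544950762296878825853663232 / 14603137969970703125 * (z - 1 / 2) ^ 10 * (3 / 4 - z) ^ 8 +
          10081065825895548727636265742336 / 116825103759765625 * (z - 1 / 2) ^ 11 * (3 / 4 - z) ^ 7 +
          2358470222489371874808496006375424 / 43809413909912109375 * (z - 1 / 2) ^ 12 * (3 / 4 - z) ^ 6 +
          384344004601892919540660171088896 / 14603137969970703125 * (z - 1 / 2) ^ 13 * (3 / 4 - z) ^ 5 +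
          143717223163082346753848913951744 / 14603137969970703125 * (z - 1 / 2) ^ 14 * (3 / 4 - z) ^ 4 +
          118774626755922621457152660396544 / 43809413909912109375 * (z - 1 / 2) ^ 15 * (3 / 4 - z) ^ 3 +
          7554746889094092561214870121344 / 14603137969970703125 * (z - 1 / 2) ^ 16 * (3 / 4 - z) ^ 2 +
          889768853064418451629460966144 / 14603137969970703125 * (z - 1 / 2) ^ 17 * (3 / 4 - z) +
          145844323020781219271654996992 / 43809413909912109375 * (z - 1 / 2) ^ 18) ?_ ?_
        · positivity
        · simp only [evalL]; ring
      · have h0 : 0 ≤ z - 3 / 4 := sub_nonneg.2 hl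
        have h1 : 0 ≤ 1 - z := sub_nonneg.2 hz.2
        refine le_of_le_of_eq (b :=
          145844323020781219271654996992 / 43809413909912109375 * (1 - z) ^ 18 +
          3511685808918188488287342848 / 59604644775390625 * (z - 3 / 4) * (1 - z) ^ 17 +
          1007835397306176276747259522688 / 2086162567138671875 * (z - 3 / 4) ^ 2 * (1 - z) ^ 16 +
          106450047075639150765558394869248 / 43809413909912109375 * (z - 3 / 4) ^ 3 * (1 - z) ^ 15 +
          122086253397733683214601863317504 / 14603137969970703125 * (z - 3 / 4) ^ 4 * (1 - z) ^ 14 +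
          60632601219792602686715000398848 / 2920627593994140625 * (z - 3 / 4) ^ 5 * (1 - z) ^ 13 +
          1673541575815661987733573944233984 / 43809413909912109375 * (z - 3 / 4) ^ 6 * (1 - z) ^ 12 +
          766916581436133691212121222877184 / 14603137969970703125 * (z - 3 / 4) ^ 7 * (1 - z) ^ 11 +
          780778037250469404261201774483456 / 14603137969970703125 * (z - 3 / 4) ^ 8 * (1 - z) ^ 10 +
          1711207500598271464841988012630016 / 43809413909912109375 * (z - 3 / 4) ^ 9 * (1 - z) ^ 9 +
          39836640067104087359255722688512 / 2086162567138671875 * (z - 3 / 4) ^ 10 * (1 - z) ^ 8 +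
          81417786742368631327473134403584 / 14603137969970703125 * (z - 3 / 4) ^ 11 * (1 - z) ^ 7 +
          72086930148166093540602240303104 / 43809413909912109375 * (z - 3 / 4) ^ 12 * (1 - z) ^ 6 +
          32802436142005790443888597008384 / 14603137969970703125 * (z - 3 / 4) ^ 13 * (1 - z) ^ 5 +
          7149290600261573031513226739712 / 2920627593994140625 * (z - 3 / 4) ^ 14 * (1 - z) ^ 4 +
          2612680990621050680109344751616 / 1752376556396484375 * (z - 3 / 4) ^ 15 * (1 - z) ^ 3 +
          1560473787959489485179677835264 / 2920627593994140625 * (z - 3 / 4) ^ 16 * (1 - z) ^ 2 +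
          313802277547378857227071782912 / 2920627593994140625 * (z - 3 / 4) ^ 17 * (1 - z) +
          221042199054046945538473984 / 23365020751953125 * (z - 3 / 4) ^ 18) ?_ ?_
        · positivity
        · simp only [evalL]; ring

theorem lambdaG_simonsCurve_lt_three {cn R : ℝ} (hcn : 0 < cn) (hR : 0 < R) :
    lambdaG (3 + 1) cn 2 (simonsCurve R) < 9569 / 500 * (20399 / 21875) ^ 2 / R ^ 2 := by
  refine (lambdaG_simonsCurve_le (m := 3)
    (ω := [1, 0, -12 / 5, 0, 11 / 5, 0, -11 / 10, 0, 2 / 5, 0, -1 / 10])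
    (N := [0, 0, 0, 0, 0, 0, 0, 0, 0, 64 / 25, 0, -192 / 25, 0, 704 / 65, 0, -1224 / 125, 0, 161 / 25,
           0, -1496 / 475, 0, 586 / 525, 0, -32 / 115, 0, 1 / 25])
    (D := [0, 0, 0, 0, 0, 0, 0, 1 / 7, 0, -8 / 15, 0, 254 / 275, 0, -319 / 325, 0, 91 / 125, 0,
           -174 / 425, 0, 69 / 380, 0, -11 / 175, 0, 19 / 1150, 0, -2 / 625, 0, 1 / 2700])
    ?_ (fun u => ?_) (fun u => ?_) ?_ hcn hR).trans_lt
      (div_lt_div_of_pos_right ?_ (by positivity))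
  · norm_num [evalL]
  · simp only [evalL, derivL]; ring
  · simp only [evalL, derivL]; ring
  · norm_num [evalL]
  · norm_num [evalL]

/-- Weight exponent `4`: coefficients of the flux polynomial. -/
def fluxFour : List ℝ :=
  [28081 / 5000, -457 / 25, 446979 / 10000, -1144027 / 10000, 668001 / 2500, -5002767 / 10000,
   7007077 / 10000, -6935313 / 10000, 2262707 / 5000, -433441 / 2500, 58823 / 2000]

/-- Weight exponent `4`: coefficients of the supersolution. -/
def superFour : List ℝ :=
  [4503917269493 / 4504500000000, -28081 / 10000, 12006689 / 3125000, -65290897 / 12500000,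
   483138751 / 50000000, -134989953 / 7812500, 567471813 / 25000000, -205640143 / 12500000,
   -481686243 / 100000000, 1583056687 / 56250000, -219385297 / 6250000, 3331581581 / 137500000,
   -124661577 / 12500000, 23544981 / 10156250, -529407 / 2187500]

theorem isSupersolution_four : IsSupersolution 4 (28081 / 1000) fluxFour superFour := by
  refine ⟨fun z hz => ?_, fun z => ?_, fun z hz => ?_⟩
  · have h0 : 0 ≤ z := hz.1
    have h1 : 0 ≤ 1 - z := sub_nonneg.2 hz.2
    have h : evalL superFour z = 1 / 20000 + (
        4503692044493 / 4504500000000 * (1 - z) ^ 14 +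
        3600185869493 / 321750000000 * z * (1 - z) ^ 13 +
        2886865648253 / 49500000000 * z ^ 2 * (1 - z) ^ 12 +
        2299093392743 / 12375000000 * z ^ 3 * (1 - z) ^ 11 +
        1815713602523 / 4500000000 * z ^ 4 * (1 - z) ^ 10 +
        1420176158279 / 2250000000 * z ^ 5 * (1 - z) ^ 9 +
        1095707524139 / 1500000000 * z ^ 6 * (1 - z) ^ 8 +
        416469021877 / 656250000 * z ^ 7 * (1 - z) ^ 7 +
        155291955371 / 375000000 * z ^ 8 * (1 - z) ^ 6 +
        18772943911 / 93750000 * z ^ 9 * (1 - z) ^ 5 +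
        13080721 / 187500 * z ^ 10 * (1 - z) ^ 4 +
        623730367 / 37500000 * z ^ 11 * (1 - z) ^ 3 +
        12114851 / 5000000 * z ^ 12 * (1 - z) ^ 2 +
        204463 / 1250000 * z ^ 13 * (1 - z) +
        1 / 20000 * z ^ 14) := by
      simp only [superFour, evalL]; ring
    rw [h]; positivity
  · simp only [superFour, fluxFour, derivL, evalL, profV]; ring
  · have h : 4 * profA z * evalL fluxFour z +
        profX z * profW z * (evalL fluxFour z + 2 * z * derivL fluxFour z) -
        28081 / 1000 * (profX z * profW z) * profV z * evalL superFour z =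
        evalL [161983824478596233 / 98535937500000000000, 102798851651854795421 / 3421386718750000000000,
         -94572676278474914813291 / 70495605468750000000000,
         479615283604745882437709979 / 18710708618164062500000000,
         -18485032022878092171056819083 / 74842834472656250000000000,
         361268487654014687360876811 / 261688232421875000000000,
         -4533387752840065338238437721 / 935535430908203125000000,
         2993228103896783970613329223 / 267295837402343750000000,
         -375413385993575564697346841751 / 21383666992187500000000000,
         12867660309061079093698766627 / 672912597656250000000000,
         -1113994619498642870861206821 / 74768066406250000000000,
         1062297906525884689864418003 / 123367309570312500000000,
         -148985575516038039202235079 / 41122436523437500000000,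
         96110498848207990229966469 / 133647918701171875000000,
         117011567774158763981944671 / 267295837402343750000000,
         -351578475088092512050761 / 642538070678710937500,
         1008537921786417747432147 / 3037452697753906250000,
         -8492834685573920075946597 / 58470964431762695312500,
         54879861777779514624399 / 1124441623687744140625,
         -7230711720754237910346 / 584709644317626953125,
         117509988413708410878 / 53155422210693359375, -2972403193072464 / 12149810791015625,
         57800088735696 / 4673004150390625] z := by
      simp only [fluxFour, superFour, derivL, evalL, profA, profX, profW, profV]; ring
    push_cast
    rw [h]
    rcases le_total z (1 / 2) with hu | hl
    · have h0 : 0 ≤ z := hz.1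
      have h1 : 0 ≤ 1 / 2 - z := sub_nonneg.2 hu
      refine le_of_le_of_eq (b :=
        331742872532165085184 / 48113250732421875 * (1 / 2 - z) ^ 22 +
        6456252930964257510479872 / 30070781707763671875 * z * (1 / 2 - z) ^ 21 +
        64321379039140763221685248 / 42617321014404296875 * z ^ 2 * (1 / 2 - z) ^ 20 +
        6022609226685441339819194390528 / 657798349857330322265625 * z ^ 3 * (1 / 2 - z) ^ 19 +
        1514682042708455533393532628224 / 26311933994293212890625 * z ^ 4 * (1 / 2 - z) ^ 18 +
        2805325457231916538171122379008 / 10441243648529052734375 * z ^ 5 * (1 / 2 - z) ^ 17 +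
        5364053055510299782992047686144 / 6264746189117431640625 * z ^ 6 * (1 / 2 - z) ^ 16 +
        424996757360146838388205442352896 / 219266116619110107421875 * z ^ 7 * (1 / 2 - z) ^ 15 +
        3722138969221263931481615759352 / 1124441623687744140625 * z ^ 8 * (1 / 2 - z) ^ 14 +
        9548027815001073846972447241016 / 2088248729705810546875 * z ^ 9 * (1 / 2 - z) ^ 13 +
        49497601184142658040979003676 / 8995532989501953125 * z ^ 10 * (1 / 2 - z) ^ 12 +
        6817358091153814930626001291576 / 1124441623687744140625 * z ^ 11 * (1 / 2 - z) ^ 11 +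
        2927279070739277439632771029204 / 481903553009033203125 * z ^ 12 * (1 / 2 - z) ^ 10 +
        23627180594036013362057481815648 / 4474818706512451171875 * z ^ 13 * (1 / 2 - z) ^ 9 +
        55535975574170525547176950650066 / 14617741107940673828125 * z ^ 14 * (1 / 2 - z) ^ 8 +
        160403886060417360588642896208352 / 73088705539703369140625 * z ^ 15 * (1 / 2 - z) ^ 7 +
        2086770426350467133818649225388 / 2088248729705810546875 * z ^ 16 * (1 / 2 - z) ^ 6 +
        25859365453393976799637649895864 / 73088705539703369140625 * z ^ 17 * (1 / 2 - z) ^ 5 +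
        63096552191878211273847864528004 / 657798349857330322265625 * z ^ 18 * (1 / 2 - z) ^ 4 +
        365198283751565070387014854184 / 18794238567352294921875 * z ^ 19 * (1 / 2 - z) ^ 3 +
        4185894462415665164662017432 / 1491606235504150390625 * z ^ 20 * (1 / 2 - z) ^ 2 +
        2639113371795185384468153696 / 10119974613189697265625 * z ^ 21 * (1 / 2 - z) +
        705826492597638910323825674 / 59799849987030029296875 * z ^ 22) ?_ ?_
      · positivity
      · simp only [evalL]; ring
    · rcases le_total z (3 / 4) with hu | hl
      · have h0 : 0 ≤ z - 1 / 2 := sub_nonneg.2 hl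
        have h1 : 0 ≤ 3 / 4 - z := sub_nonneg.2 hu
        refine le_of_le_of_eq (b :=
          2960450881208247272126863319760896 / 59799849987030029296875 * (3 / 4 - z) ^ 22 +
          714893247295937679520521150181408768 / 657798349857330322265625 * (z - 1 / 2) * (3 / 4 - z) ^ 21 +
          17072900783010597060664600851120128 / 1491606235504150390625 * (z - 1 / 2) ^ 2 * (3 / 4 - z) ^ 20 +
          289385018828995677360069516646678528 / 3758847713470458984375 * (z - 1 / 2) ^ 3 * (3 / 4 - z) ^ 19 +
          22196566556920831767035570554959036416 / 59799849987030029296875 * (z - 1 / 2) ^ 4 * (3 / 4 - z) ^ 18 +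
          7668085077668237366305013566737481728 / 5622208118438720703125 * (z - 1 / 2) ^ 5 * (3 / 4 - z) ^ 17 +
          57920297293015979030924744143413313536 / 14617741107940673828125 * (z - 1 / 2) ^ 6 * (3 / 4 - z) ^ 16 +
          680815026414592301155864363559466041344 / 73088705539703369140625 * (z - 1 / 2) ^ 7 * (3 / 4 - z) ^ 15 +
          37558894433118070054110493893160894464 / 2088248729705810546875 * (z - 1 / 2) ^ 8 * (3 / 4 - z) ^ 14 +
          13874369064347346822978399587989553152 / 481903553009033203125 * (z - 1 / 2) ^ 9 * (3 / 4 - z) ^ 13 +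
          92553861521004888146403385889058873344 / 2409517765045166015625 * (z - 1 / 2) ^ 10 * (3 / 4 - z) ^ 12 +
          240692529256598728268843813411800875008 / 5622208118438720703125 * (z - 1 / 2) ^ 11 * (3 / 4 - z) ^ 11 +
          224036469781730495157437373433850472448 / 5622208118438720703125 * (z - 1 / 2) ^ 12 * (3 / 4 - z) ^ 10 +
          451625655604288412091252397180361455616 / 14617741107940673828125 * (z - 1 / 2) ^ 13 * (3 / 4 - z) ^ 9 +
          1451056945338083417851741829929380407808 / 73088705539703369140625 * (z - 1 / 2) ^ 14 * (3 / 4 - z) ^ 8 +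
          41826404326012629988708225155085377536 / 3986656665802001953125 * (z - 1 / 2) ^ 15 * (3 / 4 - z) ^ 7 +
          141223143841731451070265883619549537024 / 31323730945587158203125 * (z - 1 / 2) ^ 16 * (3 / 4 - z) ^ 6 +
          16187401251681525310889608878826628352 / 10441243648529052734375 * (z - 1 / 2) ^ 17 * (3 / 4 - z) ^ 5 +
          120495739350584075568207690168682496 / 289142131805419921875 * (z - 1 / 2) ^ 18 * (3 / 4 - z) ^ 4 +
          7940434045572360011761408130505682304 / 93971192836761474609375 * (z - 1 / 2) ^ 19 * (3 / 4 - z) ^ 3 +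
          127216800676223331481611884744978976 / 10441243648529052734375 * (z - 1 / 2) ^ 20 * (3 / 4 - z) ^ 2 +
          20995921950509641158005188634544448 / 18794238567352294921875 * (z - 1 / 2) ^ 21 * (3 / 4 - z) +
          355217749467335807673166145485328 / 7228553295135498046875 * (z - 1 / 2) ^ 22) ?_ ?_
        · positivity
        · simp only [evalL]; ring
      · have h0 : 0 ≤ z - 3 / 4 := sub_nonneg.2 hl
        have h1 : 0 ≤ 1 - z := sub_nonneg.2 hz.2
        refine le_of_le_of_eq (b :=
          355217749467335807673166145485328 / 7228553295135498046875 * (1 - z) ^ 22 +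
          98204942942767876199025092044885376 / 93971192836761474609375 * (z - 3 / 4) * (1 - z) ^ 21 +
          22281848957347179153855313089338592 / 2088248729705810546875 * (z - 3 / 4) ^ 2 * (1 - z) ^ 20 +
          6566416760416049414931367973530199936 / 93971192836761474609375 * (z - 3 / 4) ^ 3 * (1 - z) ^ 19 +
          31075400584985599931959000322333704448 / 93971192836761474609375 * (z - 3 / 4) ^ 4 * (1 - z) ^ 18 +
          12594974976254908013038326881541395712 / 10441243648529052734375 * (z - 3 / 4) ^ 5 * (1 - z) ^ 17 +
          3153815156403171559426173484636717312 / 894963741302490234375 * (z - 3 / 4) ^ 6 * (1 - z) ^ 16 +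
          168091414922444862408742248394280599552 / 19933283329010009765625 * (z - 3 / 4) ^ 7 * (1 - z) ^ 15 +
          1222560114438683908439694785567495318016 / 73088705539703369140625 * (z - 3 / 4) ^ 8 * (1 - z) ^ 14 +
          18172711840246840286472125526569488596992 / 657798349857330322265625 * (z - 3 / 4) ^ 9 * (1 - z) ^ 13 +
          174622604227278974821482738692254314496 / 4599988460540771484375 * (z - 3 / 4) ^ 10 * (1 - z) ^ 12 +
          34691791241898622844814113447596834816 / 803172588348388671875 * (z - 3 / 4) ^ 11 * (1 - z) ^ 11 +
          185669262824842356190716683443046662144 / 4599988460540771484375 * (z - 3 / 4) ^ 12 * (1 - z) ^ 10 +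
          20111049096123708308154885126024527872 / 657141208648681640625 * (z - 3 / 4) ^ 13 * (1 - z) ^ 9 +
          9456688679515919016634758449608654848 / 511109828948974609375 * (z - 3 / 4) ^ 14 * (1 - z) ^ 8 +
          2666304642729648163994593607154663424 / 306665897369384765625 * (z - 3 / 4) ^ 15 * (1 - z) ^ 7 +
          669226460573352718297811044901322752 / 219047069549560546875 * (z - 3 / 4) ^ 16 * (1 - z) ^ 6 +
          7885611218275704124135357789765632 / 10430812835693359375 * (z - 3 / 4) ^ 17 * (1 - z) ^ 5 +
          5324630633677621832341735098810368 / 43809413909912109375 * (z - 3 / 4) ^ 18 * (1 - z) ^ 4 +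
          614699970099959948988407928061952 / 43809413909912109375 * (z - 3 / 4) ^ 19 * (1 - z) ^ 3 +
          1838272758012009049529270665216 / 584125518798828125 * (z - 3 / 4) ^ 20 * (1 - z) ^ 2 +
          2680228040781559796345346195456 / 2920627593994140625 * (z - 3 / 4) ^ 21 * (1 - z) +
          2582255863046264082554421248 / 23365020751953125 * (z - 3 / 4) ^ 22) ?_ ?_
        · positivity
        · simp only [evalL]; ring

theorem lambdaG_simonsCurve_lt_four {cn R : ℝ} (hcn : 0 < cn) (hR : 0 < R) :
    lambdaG (4 + 1) cn 2 (simonsCurve R) < 28081 / 1000 * (20399 / 21875) ^ 2 / R ^ 2 := by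
  refine (lambdaG_simonsCurve_le (m := 4)
    (ω := [1, 0, -68 / 25, 0, 151 / 50, 0, -47 / 25, 0, 19 / 25, 0, -11 / 50, 0, 1 / 25])
    (N := [0, 0, 0, 0, 0, 0, 0, 0, 0, 0, 0, 18496 / 6875, 0, -82144 / 8125, 0, 167908 / 9375, 0,
           -211672 / 10625, 0, 186292 / 11875, 0, -122212 / 13125, 0, 61372 / 14375, 0, -23488 / 15625,
           0, 6673 / 16875, 0, -264 / 3625, 0, 144 / 19375])
    (D := [0, 0, 0, 0, 0, 0, 0, 0, 0, 1 / 9, 0, -136 / 275, 0, 8399 / 8125, 0, -4206 / 3125, 0,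
           52169 / 42500, 0, -524 / 625, 0, 5876 / 13125, 0, -1101 / 5750, 0, 1029 / 15625, 0,
           -101 / 5625, 0, 273 / 72500, 0, -11 / 19375, 0, 1 / 20625])
    ?_ (fun u => ?_) (fun u => ?_) ?_ hcn hR).trans_lt
      (div_lt_div_of_pos_right ?_ (by positivity))
  · norm_num [evalL]
  · simp only [evalL, derivL]; ring
  · simp only [evalL, derivL]; ring
  · norm_num [evalL]
  · norm_num [evalL]

/-- For `2 ≤ n ≤ 5`, `p = 2` and `x₀ = y₀ = R > 0`,
`λ_{1,2}(σ) < sup{λ_{1,2}(α) : α ∈ 𝒞}`. -/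
theorem simons_stmt3 (n : ℕ) (hn2 : 2 ≤ n) (hn5 : n ≤ 5) (cn : ℝ) (hcn : 0 < cn)
    (R : ℝ) (hR : 0 < R) :
    ∃ α : ℝ → ℝ × ℝ, MemC R R α ∧
      lambdaG n cn 2 (simonsCurve R) < lambdaG n cn 2 α := by
  refine ⟨competitor R, memC_competitor hR, ?_⟩
  interval_cases n
  · exact (lambdaG_simonsCurve_lt_one hcn hR).trans_le
      (isSupersolution_one.le_lambdaG (by norm_num) hcn hR)
  · exact (lambdaG_simonsCurve_lt_two hcn hR).trans_le
      (isSupersolution_two.le_lambdaG (by norm_num) hcn hR)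
  · exact (lambdaG_simonsCurve_lt_three hcn hR).trans_le
      (isSupersolution_three.le_lambdaG (by norm_num) hcn hR)
  · exact (lambdaG_simonsCurve_lt_four hcn hR).trans_le
      (isSupersolution_four.le_lambdaG (by norm_num) hcn hR)
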